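/- arXiv:1505.07029 — 3 statements merged into one kernel-verified Lean document; each statement's English description precedes it below -/
import Mathlib

section
/- Let (H, d) be an Hadamard space and G a finite set of pixels with neighborhoods N(i)⁺ such that every pixel is connected to a fixed pixel i₀ ∈ V by a neighbor path. Let φ: ℝ≥0 → ℝ≥0 and, if V ≠ G, additionally assume φ is coercive. Then J₁(u) := (1/2)Σ_{i∈V} d(u_i,f_i)² + λ Σ_{i∈G} Σ_{j∈N(i)⁺} φ(d(u_i,u_j)) (λ > 0) is coercive on H^G and hence, if additionally φ is lsc so that J₁ is lsc and convex, has a minimizer. -/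
open Filter

/-- A curve `γ : [0,1] → H` is a (constant-speed) geodesic segment. -/
def IsGeodesicSeg {H : Type*} [MetricSpace H] (γ : ℝ → H) : Prop :=
  ∀ s ∈ Set.Icc (0 : ℝ) 1, ∀ t ∈ Set.Icc (0 : ℝ) 1,
    dist (γ s) (γ t) = |s - t| * dist (γ 0) (γ 1)

section Aux

variable {H : Type*} [MetricSpace H]

lemma aux_limit (A B C : ℝ) (h : ∀ e : ℝ, 0 < e → e < 1 → A - e * C ≤ B) : A ≤ B := by
  have h1 : Tendsto (fun e : ℝ => A - e * C) (nhdsWithin 0 (Set.Ioi 0)) (nhds A) := by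
    have : Tendsto (fun e : ℝ => A - e * C) (nhds 0) (nhds (A - 0 * C)) :=
      Continuous.tendsto (by fun_prop) 0
    rw [zero_mul, sub_zero] at this
    exact this.mono_left nhdsWithin_le_nhds
  refine le_of_tendsto h1 ?_
  filter_upwards [Ioo_mem_nhdsGT (show (0:ℝ) < 1 by norm_num)] with e he
  exact h e he.1 he.2

lemma aux_conv
    (hgeo : ∀ x y : H, ∃ γ : ℝ → H, γ 0 = x ∧ γ 1 = y ∧ IsGeodesicSeg γ)
    (hcat : ∀ x y v w : H,
      dist x v ^ 2 + dist y w ^ 2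
        ≤ dist x w ^ 2 + dist y v ^ 2 + 2 * dist x y * dist v w)
    (p m x y : H) (A : ℝ) (hx : dist x m = A) (hy : dist y m = A) (hxy : dist x y = 2 * A) :
    2 * dist p m ≤ dist p x + dist p y := by
  obtain ⟨c, c0, c1, hc⟩ := hgeo m p
  have hA : 0 ≤ A := hx ▸ dist_nonneg
  set r := dist p m with hr
  have hr0 : 0 ≤ r := dist_nonneg
  have key : 2 * r ^ 2 ≤ r * (dist p x + dist p y) := by
    refine aux_limit _ _ (r ^ 2) fun e he0 he1 => ?_
    have hmq : dist m (c e) = e * r := by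
      have := hc 0 (by simp) e ⟨he0.le, he1.le⟩
      rw [c0, c1, zero_sub, abs_neg, abs_of_pos he0, dist_comm m p] at this
      exact this
    have hpq : dist p (c e) = (1 - e) * r := by
      have := hc 1 (by simp) e ⟨he0.le, he1.le⟩
      rw [c0, c1, abs_of_pos (by linarith), dist_comm m p] at this
      exact this
    have h1 := hcat p x m (c e)
    have h2 := hcat p y m (c e)
    have h3 := dist_triangle_right x y (c e)
    rw [hmq, hpq, ← hr] at h1 h2
    rw [hx] at h1
    rw [hy] at h2
    rw [hxy] at h3
    have h4 : 2 * A ^ 2 ≤ dist x (c e) ^ 2 + dist y (c e) ^ 2 := by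
      nlinarith [sq_nonneg (dist x (c e) - dist y (c e)), dist_nonneg (x := x) (y := c e)]
    have h5 : e * (2 * r ^ 2 - e * r ^ 2) ≤ e * (r * (dist p x + dist p y)) := by nlinarith
    exact le_of_mul_le_mul_left h5 he0
  rcases hr0.eq_or_lt with h | h
  · rw [← h]; have := dist_nonneg (x := p) (y := x); have := dist_nonneg (x := p) (y := y); linarith
  · have : r * (2 * r) ≤ r * (dist p x + dist p y) := by nlinarith
    exact le_of_mul_le_mul_left this h

lemma aux_half
    (hcat : ∀ x y v w : H,
      dist x v ^ 2 + dist y w ^ 2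
        ≤ dist x w ^ 2 + dist y v ^ 2 + 2 * dist x y * dist v w)
    (m x p x' q : H) (a b e : ℝ) (he : 0 < e)
    (hmx : dist m x = a) (hmp : dist m p = b)
    (hmx' : dist m x' = e * a) (hx'x : dist x' x = (1 - e) * a)
    (hmq : dist m q = e * b) (hqp : dist q p = (1 - e) * b) :
    dist x' p ^ 2 + dist q x ^ 2 ≤
      (1 - e) ^ 2 * (a ^ 2 + b ^ 2) + 2 * e * dist x p ^ 2 + e ^ 2 * (a ^ 2 + b ^ 2) := by
  obtain ⟨k, hk⟩ : ∃ k, dist x' q = e * k := ⟨dist x' q / e, by field_simp⟩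
  have t := hcat x' q p x
  have h1 := hcat x' p q m
  have h2 := hcat q x x' m
  simp only [dist_comm p q, dist_comm p m, dist_comm x' m, dist_comm q m, dist_comm q x',
    dist_comm x x', dist_comm p x, dist_comm x m, hmx, hmp, hmx', hx'x, hmq, hqp, hk] at t h1 h2
  generalize dist x' p = X at *
  generalize dist q x = Y at *
  generalize dist x p = c at *
  have g1 : e ^ 2 * k ^ 2 ≤ e ^ 2 * (a ^ 2 + b ^ 2) + 2 * e * (b * (X - b)) := by nlinarith
  have g2 : e ^ 2 * k ^ 2 ≤ e ^ 2 * (a ^ 2 + b ^ 2) + 2 * e * (a * (Y - a)) := by nlinarith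
  have g3 : a ^ 2 + b ^ 2 + 2 * (b * (X - b)) + 2 * (a * (Y - a)) ≤ X ^ 2 + Y ^ 2 := by
    nlinarith [sq_nonneg (X - b), sq_nonneg (Y - a)]
  have g4 : 2 * (b * (X - b)) + 2 * (a * (Y - a)) ≤
      ((1 - e) ^ 2 - 1) * (a ^ 2 + b ^ 2) + 2 * e * (k * c) := by nlinarith
  have g5 := mul_le_mul_of_nonneg_left g4 he.le
  have g6 : e ^ 2 * (2 * k ^ 2) ≤ e ^ 2 * (e * (a ^ 2 + b ^ 2) + 2 * (k * c)) := by nlinarith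
  have g7 := le_of_mul_le_mul_left g6 (by positivity)
  have g8 : 2 * (k * c) ≤ 2 * c ^ 2 + e * (a ^ 2 + b ^ 2) := by nlinarith [sq_nonneg (k - c)]
  have g9 := mul_le_mul_of_nonneg_left g8 he.le
  nlinarith

lemma aux_CN
    (hgeo : ∀ x y : H, ∃ γ : ℝ → H, γ 0 = x ∧ γ 1 = y ∧ IsGeodesicSeg γ)
    (hcat : ∀ x y v w : H,
      dist x v ^ 2 + dist y w ^ 2
        ≤ dist x w ^ 2 + dist y v ^ 2 + 2 * dist x y * dist v w)
    (γ : ℝ → H) (hγ : IsGeodesicSeg γ) (p : H) :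
    dist (γ 0) (γ 1) ^ 2 ≤
      2 * (dist (γ 0) p ^ 2 + dist (γ 1) p ^ 2) - 4 * dist (γ (1 / 2)) p ^ 2 := by
  obtain ⟨c, c0, c1, hc⟩ := hgeo (γ (1 / 2)) p
  obtain ⟨a, ha⟩ : ∃ a, dist (γ 0) (γ 1) = 2 * a := ⟨dist (γ 0) (γ 1) / 2, by ring⟩
  have ha0 : 0 ≤ a := by have := dist_nonneg (x := γ 0) (y := γ 1); linarith
  obtain ⟨b, hb⟩ : ∃ b, dist (γ (1 / 2)) p = b := ⟨_, rfl⟩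
  have hb0 : 0 ≤ b := hb ▸ dist_nonneg
  have key : 2 * (a ^ 2 + b ^ 2) ≤ dist (γ 0) p ^ 2 + dist (γ 1) p ^ 2 := by
    refine aux_limit _ _ (2 * (a ^ 2 + b ^ 2)) fun e he0 he1 => ?_
    have d : ∀ s t : ℝ, 0 ≤ s → s ≤ t → t ≤ 1 → dist (γ s) (γ t) = (t - s) * (2 * a) := by
      intro s t h0 h1 h2
      rw [hγ s ⟨h0, h1.trans h2⟩ t ⟨h0.trans h1, h2⟩, ha, abs_sub_comm,
        abs_of_nonneg (by linarith)]
    have hmq : dist (γ (1 / 2)) (c e) = e * b := by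
      have := hc 0 (by simp) e ⟨he0.le, he1.le⟩
      rw [c0, c1, zero_sub, abs_neg, abs_of_pos he0, hb] at this
      exact this
    have hqp : dist (c e) p = (1 - e) * b := by
      have := hc e ⟨he0.le, he1.le⟩ 1 (by simp)
      rw [c0, c1, abs_sub_comm, abs_of_pos (by linarith), hb] at this
      exact this
    have d0 : dist (γ (1 / 2)) (γ 0) = a := by
      rw [dist_comm, d _ _ (by norm_num) (by norm_num) (by norm_num)]; ring
    have d1 : dist (γ (1 / 2)) (γ 1) = a := by
      rw [d _ _ (by norm_num) (by norm_num) (by norm_num)]; ring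
    have e0 : dist (γ (1 / 2)) (γ (1 / 2 - e / 2)) = e * a := by
      rw [dist_comm, d _ _ (by linarith) (by linarith) (by norm_num)]; ring
    have e1 : dist (γ (1 / 2)) (γ (1 / 2 + e / 2)) = e * a := by
      rw [d _ _ (by linarith) (by linarith) (by linarith)]; ring
    have f0 : dist (γ (1 / 2 - e / 2)) (γ 0) = (1 - e) * a := by
      rw [dist_comm, d _ _ (by linarith) (by linarith) (by linarith)]; ring
    have f1 : dist (γ (1 / 2 + e / 2)) (γ 1) = (1 - e) * a := by
      rw [d _ _ (by linarith) (by linarith) (by linarith)]; ring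
    have e2 : dist (γ (1 / 2 - e / 2)) (γ (1 / 2 + e / 2)) = 2 * (e * a) := by
      rw [d _ _ (by linarith) (by linarith) (by linarith)]; ring
    have A0 := aux_half hcat _ _ _ _ _ a b e he0 d0 hb e0 f0 hmq hqp
    have A1 := aux_half hcat _ _ _ _ _ a b e he0 d1 hb e1 f1 hmq hqp
    have B := aux_conv hgeo hcat p (γ (1 / 2)) _ _ (e * a) (by rw [dist_comm, e0])
      (by rw [dist_comm, e1]) e2
    rw [dist_comm p, hb, dist_comm p, dist_comm p] at B
    have C := dist_triangle_left (γ 0) (γ 1) (c e)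
    rw [ha] at C
    generalize dist (γ (1 / 2 - e / 2)) p = X at *
    generalize dist (γ (1 / 2 + e / 2)) p = X' at *
    generalize dist (c e) (γ 0) = Y at *
    generalize dist (c e) (γ 1) = Y' at *
    have B2 : 2 * b ^ 2 ≤ X ^ 2 + X' ^ 2 := by nlinarith [sq_nonneg (X - X')]
    have C2 : 2 * a ^ 2 ≤ Y ^ 2 + Y' ^ 2 := by nlinarith [sq_nonneg (Y - Y')]
    have D : (2 * e) * (2 * (a ^ 2 + b ^ 2) - e * (2 * (a ^ 2 + b ^ 2))) ≤
        (2 * e) * (dist (γ 0) p ^ 2 + dist (γ 1) p ^ 2) := by nlinarith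
    exact le_of_mul_le_mul_left D (by positivity)
  rw [ha, hb]
  nlinarith

lemma aux_min [CompleteSpace H]
    (hgeo : ∀ x y : H, ∃ γ : ℝ → H, γ 0 = x ∧ γ 1 = y ∧ IsGeodesicSeg γ)
    (hcat : ∀ x y v w : H,
      dist x v ^ 2 + dist y w ^ 2
        ≤ dist x w ^ 2 + dist y v ^ 2 + 2 * dist x y * dist v w)
    {G : Type*} [Fintype G] (J : (G → H) → ℝ) (p : G → H) (hJ0 : ∀ u, 0 ≤ J u)
    (hb : ∀ M : ℝ, ∃ R : ℝ, ∀ u, J u ≤ M → ∀ i, dist (u i) (p i) ≤ R)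
    (hl : LowerSemicontinuous J)
    (hc : ∀ γ : G → ℝ → H, (∀ i, IsGeodesicSeg (γ i)) → ∀ t ∈ Set.Icc (0 : ℝ) 1,
          J (fun i => γ i t) ≤ (1 - t) * J (fun i => γ i 0) + t * J (fun i => γ i 1)) :
    ∃ u : G → H, ∀ w : G → H, J u ≤ J w := by
  have hbd : BddBelow (Set.range J) := ⟨0, by rintro _ ⟨u, rfl⟩; exact hJ0 u⟩
  have hne : (Set.range J).Nonempty := ⟨_, p, rfl⟩
  set I := sInf (Set.range J) with hI
  have hIle : ∀ w, I ≤ J w := fun w => csInf_le hbd ⟨w, rfl⟩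
  let δ : ℕ → ℝ := fun n => 1 / ((n : ℝ) + 1)
  have hδ0 : ∀ n, 0 < δ n := fun n => Nat.one_div_pos_of_nat
  have hδa : ∀ n m, n ≤ m → δ m ≤ δ n := fun n m h => Nat.one_div_le_one_div h
  have hδt : Tendsto δ atTop (nhds 0) := tendsto_one_div_add_atTop_nhds_zero_nat
  let S : ℕ → Set (G → H) := fun n => {u | J u ≤ I + δ n}
  let E : (G → H) → ℝ := fun u => ∑ i, dist (u i) (p i) ^ 2
  have hE0 : ∀ u, 0 ≤ E u := fun u => Finset.sum_nonneg fun i _ => sq_nonneg _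
  have hSne : ∀ n, (S n).Nonempty := by
    intro n
    obtain ⟨_, ⟨u, rfl⟩, hu⟩ := exists_lt_of_csInf_lt hne
      (show sInf (Set.range J) < I + δ n by have := hδ0 n; linarith)
    exact ⟨u, hu.le⟩
  have hSa : ∀ n m, n ≤ m → S m ⊆ S n := by
    intro n m h u hu
    have := hδa n m h
    change J u ≤ _ at hu
    change J u ≤ _
    linarith
  have hEb : ∀ s : Set (G → H), BddBelow (E '' s) :=
    fun s => ⟨0, by rintro _ ⟨u, _, rfl⟩; exact hE0 u⟩
  let d : ℕ → ℝ := fun n => sInf (E '' S n)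
  have hd : ∀ n u, u ∈ S n → d n ≤ E u := fun n u hu => csInf_le (hEb _) ⟨u, hu, rfl⟩
  have hdm : Monotone d := fun n m h =>
    csInf_le_csInf (hEb _) ((hSne m).image E) (Set.image_mono (hSa n m h))
  obtain ⟨R, hR⟩ := hb (I + δ 0)
  have hdb : BddAbove (Set.range d) := by
    refine ⟨∑ i : G, R ^ 2, ?_⟩
    rintro _ ⟨n, rfl⟩
    obtain ⟨u, hu⟩ := hSne n
    refine (hd n u hu).trans (Finset.sum_le_sum fun i _ => ?_)
    have := hR u (hSa 0 n (Nat.zero_le _) hu) i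
    exact pow_le_pow_left₀ dist_nonneg this 2
  have hdt := tendsto_atTop_ciSup hdm hdb
  set l := ⨆ n, d n with hldef
  have hdl : ∀ n, d n ≤ l := fun n => le_ciSup hdb n
  have hex : ∀ n, ∃ u ∈ S n, E u < d n + δ n := by
    intro n
    obtain ⟨_, ⟨u, hu, rfl⟩, h⟩ := exists_lt_of_csInf_lt ((hSne n).image E)
      (show sInf (E '' S n) < d n + δ n by
        have := hδ0 n
        change d n < _
        linarith)
    exact ⟨u, hu, h⟩
  choose u huS huE using hex
  have hbt : Tendsto (fun n => Real.sqrt (4 * (l - d n) + 4 * δ n)) atTop (nhds 0) := by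
    have : Tendsto (fun n => 4 * (l - d n) + 4 * δ n) atTop (nhds (4 * (l - l) + 4 * 0)) :=
      ((tendsto_const_nhds.sub hdt).const_mul 4).add (hδt.const_mul 4)
    have h2 := (Real.continuous_sqrt.tendsto _).comp this
    simpa [Function.comp_def] using h2
  have hcau : CauchySeq u := by
    refine cauchySeq_of_le_tendsto_0 _ (fun n m N hn hm => ?_) hbt
    choose γ g0 g1 hγ using fun i => hgeo (u n i) (u m i)
    have hmid : (fun i => γ i (1 / 2)) ∈ S N := by
      have h := hc γ hγ (1 / 2) ⟨by norm_num, by norm_num⟩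
      simp only [g0, g1] at h
      have h1 : J (u n) ≤ I + δ N := hSa N n hn (huS n)
      have h2 : J (u m) ≤ I + δ N := hSa N m hm (huS m)
      change J _ ≤ I + δ N
      change _ ≤ (1 - 1 / 2) * J (u n) + 1 / 2 * J (u m) at h
      linarith
    have hEm := hd N _ hmid
    have hsum : ∑ i, dist (u n i) (u m i) ^ 2 ≤
        2 * (E (u n) + E (u m)) - 4 * E (fun i => γ i (1 / 2)) := by
      simp only [E]
      rw [← Finset.sum_add_distrib, Finset.mul_sum, Finset.mul_sum, ← Finset.sum_sub_distrib]
      refine Finset.sum_le_sum fun i _ => ?_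
      have := aux_CN hgeo hcat (γ i) (hγ i) (p i)
      rw [g0, g1] at this
      exact this
    have k1 := huE n
    have k2 := huE m
    have k3 := hdl n
    have k4 := hdl m
    have k5 := hδa N n hn
    have k6 := hδa N m hm
    refine (dist_pi_le_iff (Real.sqrt_nonneg _)).2 fun i => ?_
    refine Real.le_sqrt_of_sq_le ?_
    have := Finset.single_le_sum (f := fun i => dist (u n i) (u m i) ^ 2)
      (fun i _ => sq_nonneg _) (Finset.mem_univ i)
    linarith
  obtain ⟨v, hv⟩ := cauchySeq_tendsto_of_complete hcau
  refine ⟨v, fun w => le_trans ?_ (hIle w)⟩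
  by_contra! hlt
  obtain ⟨y, hy1, hy2⟩ := exists_between hlt
  have h1 := hv.eventually (hl v y hy2)
  have h2 : Tendsto (fun n => I + δ n) atTop (nhds (I + 0)) := hδt.const_add I
  rw [add_zero] at h2
  have h3 := h2.eventually (gt_mem_nhds hy1)
  obtain ⟨n, hn1, hn2⟩ := (h1.and h3).exists
  have : J (u n) ≤ I + δ n := huS n
  linarith

end Aux

/-- Coercivity of the anisotropic functional `J₁` on `H^G` for an Hadamard space
`H`, a finite connected pixel set `G`, nonempty `V ⊆ G`, and `φ ≥ 0`
(coercive if `V ≠ G`); consequently, if `J₁` is in addition lower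
semicontinuous and convex, it has a minimizer. -/
theorem stmt_11 {H : Type*} [MetricSpace H] [CompleteSpace H]
    (hgeo : ∀ x y : H, ∃ γ : ℝ → H, γ 0 = x ∧ γ 1 = y ∧ IsGeodesicSeg γ)
    (hcat : ∀ x y v w : H,
      dist x v ^ 2 + dist y w ^ 2
        ≤ dist x w ^ 2 + dist y v ^ 2 + 2 * dist x y * dist v w)
    (G : Type*) [Fintype G] (V : Finset G) (N : G → Finset G)
    (i₀ : G) (hi₀ : i₀ ∈ V)
    (hconn : ∀ j : G, Relation.ReflTransGen (fun i i' => i' ∈ N i) i₀ j)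
    (f : G → H) (φ : ℝ → ℝ) (hφnn : ∀ t, 0 ≤ t → 0 ≤ φ t)
    (lam : ℝ) (hlam : 0 < lam)
    (hφcoer : V ≠ Finset.univ → Tendsto φ atTop atTop) :
    let J : (G → H) → ℝ := fun u =>
      (1 / 2) * ∑ i ∈ V, dist (u i) (f i) ^ 2
        + lam * ∑ i : G, ∑ j ∈ N i, φ (dist (u i) (u j))
    Tendsto J (Filter.comap (fun u : G → H => dist u (fun _ => f i₀)) atTop) atTop ∧
      (LowerSemicontinuous J →
        (∀ γ : G → ℝ → H, (∀ i, IsGeodesicSeg (γ i)) → ∀ t ∈ Set.Icc (0 : ℝ) 1,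
          J (fun i => γ i t) ≤ (1 - t) * J (fun i => γ i 0) + t * J (fun i => γ i 1)) →
        ∃ u : G → H, ∀ w : G → H, J u ≤ J w) := by
  intro J
  have hr : ∀ u : G → H, ∀ i j, 0 ≤ φ (dist (u i) (u j)) := fun u i j => hφnn _ dist_nonneg
  have hD0 : ∀ u : G → H, 0 ≤ ∑ i ∈ V, dist (u i) (f i) ^ 2 :=
    fun u => Finset.sum_nonneg fun i _ => sq_nonneg _
  have hR0 : ∀ u : G → H, 0 ≤ ∑ i : G, ∑ j ∈ N i, φ (dist (u i) (u j)) :=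
    fun u => Finset.sum_nonneg fun i _ => Finset.sum_nonneg fun j _ => hr u i j
  have hJ0 : ∀ u, 0 ≤ J u := fun u =>
    add_nonneg (mul_nonneg (by norm_num) (hD0 u)) (mul_nonneg hlam.le (hR0 u))
  have hdata : ∀ u M, J u ≤ M → ∀ i ∈ V, dist (u i) (f i) ≤ Real.sqrt (2 * M) := by
    intro u M hu i hi
    refine Real.le_sqrt_of_sq_le ?_
    have h1 := Finset.single_le_sum (f := fun i => dist (u i) (f i) ^ 2)
      (fun i _ => sq_nonneg _) hi
    have h2 := mul_nonneg hlam.le (hR0 u)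
    simp only [J] at hu
    linarith
  have hreg : ∀ u M, J u ≤ M → ∀ i, ∀ j ∈ N i, lam * φ (dist (u i) (u j)) ≤ M := by
    intro u M hu i j hj
    have h1 := Finset.single_le_sum (f := fun j => φ (dist (u i) (u j)))
      (fun j _ => hr u i j) hj
    have h2 := Finset.single_le_sum (f := fun i => ∑ j ∈ N i, φ (dist (u i) (u j)))
      (fun i _ => Finset.sum_nonneg fun j _ => hr u i j) (Finset.mem_univ i)
    have h3 := mul_le_mul_of_nonneg_left (h1.trans h2) hlam.le
    have h4 := hD0 u
    simp only [J] at hu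
    linarith
  have hpt : ∀ M : ℝ, ∀ j, ∃ C : ℝ, ∀ u, J u ≤ M → dist (u j) (f i₀) ≤ C := by
    intro M j
    by_cases hV : V = Finset.univ
    · refine ⟨Real.sqrt (2 * M) + dist (f j) (f i₀), fun u hu => ?_⟩
      have := hdata u M hu j (hV ▸ Finset.mem_univ j)
      have := dist_triangle (u j) (f j) (f i₀)
      linarith
    · obtain ⟨T, hT⟩ := eventually_atTop.1
        ((hφcoer hV).eventually (eventually_gt_atTop (M / lam)))
      have hedge : ∀ u, J u ≤ M → ∀ i, ∀ j ∈ N i, dist (u i) (u j) ≤ T := by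
        intro u hu i j hj
        by_contra! hlt
        have h1 := hT _ hlt.le
        rw [div_lt_iff₀ hlam] at h1
        have := hreg u M hu i j hj
        linarith
      induction hconn j with
      | refl => exact ⟨_, fun u hu => hdata u M hu i₀ hi₀⟩
      | tail _ hbc ih =>
        obtain ⟨C, hC⟩ := ih
        refine ⟨T + C, fun u hu => ?_⟩
        have h1 := hC u hu
        have h2 := hedge u hu _ _ hbc
        have h3 := dist_triangle_left (u _) (f i₀) (u _) |>.trans (add_le_add h2 h1)
        exact h3
  have hb : ∀ M : ℝ, ∃ R : ℝ, 0 ≤ R ∧ ∀ u, J u ≤ M → ∀ i, dist (u i) (f i₀) ≤ R := by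
    intro M
    choose C hC using hpt M
    refine ⟨∑ i, |C i|, Finset.sum_nonneg fun i _ => abs_nonneg _, fun u hu i => ?_⟩
    exact (hC i u hu).trans ((le_abs_self _).trans
      (Finset.single_le_sum (f := fun i => |C i|) (fun i _ => abs_nonneg _) (Finset.mem_univ i)))
  refine ⟨?_, fun hl hc => ?_⟩
  · refine tendsto_atTop.2 fun M => ?_
    obtain ⟨R, hR0, hR⟩ := hb M
    refine ((eventually_gt_atTop R).comap _).mono fun u hu => ?_
    by_contra! hlt
    have := (dist_pi_le_iff hR0).2 (hR u hlt.le)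
    exact absurd hu (not_lt.2 this)
  · refine aux_min hgeo hcat J (fun _ => f i₀) hJ0 (fun M => ?_) hl hc
    obtain ⟨R, _, hR⟩ := hb M
    exact ⟨R, hR⟩
end

section
/- Let (H, d) be an Hadamard space, φ: ℝ≥0 → ℝ≥0 increasing and convex. Then J₁(u) := (1/2)Σ_{i∈V} d(u_i,f_i)² + λ Σ_{i∈G} Σ_{j∈N(i)⁺} φ(d(u_i,u_j)) is convex on H^G; if moreover V = G or φ is strictly convex, then J₁ is strictly convex. -/
open Filter

def IsMidpt12 {H : Type*} [MetricSpace H] (m x y : H) : Prop :=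
  dist m x = dist x y / 2 ∧ dist m y = dist x y / 2

def Quad12 (H : Type*) [MetricSpace H] : Prop :=
  ∀ x y v w : H, dist x v ^ 2 + dist y w ^ 2
        ≤ dist x w ^ 2 + dist y v ^ 2 + 2 * dist x y * dist v w

def Mids12 (H : Type*) [MetricSpace H] : Prop := ∀ x y : H, ∃ m, IsMidpt12 m x y

noncomputable def sd12 {H : Type*} [MetricSpace H] (p x a y : H) : ℝ :=
  dist a y ^ 2 - (dist x y ^ 2 + dist p y ^ 2) / 2 + dist p x ^ 2 / 4

section
variable {H : Type*} [MetricSpace H]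

lemma sd12_le_one (hq : Quad12 H) {p x y a b : H} (ha : IsMidpt12 a p x) (hb : IsMidpt12 b p y) :
    sd12 p x a y ≤ 2 * dist x y * dist a b - dist x y ^ 2 / 2 := by
  have h := hq x y b a
  have h2 : dist p x ≤ dist b p + dist x b := by
    have := dist_triangle p b x
    rw [dist_comm p b, dist_comm b x] at this; exact this
  obtain ⟨h3, h4⟩ := ha
  obtain ⟨h5, h6⟩ := hb
  unfold sd12
  rw [dist_comm x a, dist_comm y b, h4, h6, dist_comm b a, dist_comm y a] at h
  rw [h5] at h2
  have := dist_nonneg (x := p) (y := x)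
  have := dist_nonneg (x := p) (y := y)
  have := dist_nonneg (x := x) (y := b)
  have h7 : dist p x ^ 2 ≤ (dist p y / 2 + dist x b) ^ 2 := by gcongr
  nlinarith [sq_nonneg (dist p y / 2 - dist x b)]

lemma sq_ab12 (hq : Quad12 H) {p x y a b m : H} (ha : IsMidpt12 a p x) (hb : IsMidpt12 b p y)
    (hm : IsMidpt12 m x y) :
    dist a b ^ 2 ≤ dist x y ^ 2 / 4 + sd12 p x a m + sd12 p y b m := by
  have h := hq p a m b
  obtain ⟨h3, h4⟩ := ha
  obtain ⟨h5, h6⟩ := hb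
  obtain ⟨h7, h8⟩ := hm
  unfold sd12
  rw [dist_comm x m, dist_comm y m, h7, h8]
  rw [dist_comm p b, dist_comm p a, h3, h5, dist_comm m b] at h
  nlinarith [sq_nonneg (dist p x / 2 - dist b m)]

lemma ab_ac12 (hq : Quad12 H) {p x y a b m c : H} (ha : IsMidpt12 a p x) (hb : IsMidpt12 b p y)
    (hm : IsMidpt12 m x y) (hc : IsMidpt12 c p m) :
    dist a b ^ 2 ≤ dist x y * (dist a c + dist b c) := by
  have h := sq_ab12 hq ha hb hm
  have h1 := sd12_le_one hq ha hc
  have h2 := sd12_le_one hq hb hc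
  obtain ⟨h7, h8⟩ := hm
  rw [dist_comm x m, h7] at h1
  rw [dist_comm y m, h8] at h2
  nlinarith

lemma lip12_aux (hq : Quad12 H) (hM : Mids12 H) (n : ℕ) : ∀ (p x y a b : H),
    IsMidpt12 a p x → IsMidpt12 b p y →
    dist a b ≤ 2 * dist x y + (1 / 2) ^ n * (dist p x + dist p y) := by
  induction n with
  | zero =>
    intro p x y a b ha hb
    have := dist_triangle a p b
    rw [ha.1, dist_comm p b, hb.1] at this
    have := dist_nonneg (x := p) (y := x)
    have := dist_nonneg (x := p) (y := y)
    have := dist_nonneg (x := x) (y := y)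
    simp; linarith
  | succ n ih =>
    intro p x y a b ha hb
    obtain ⟨m, hm⟩ := hM x y
    obtain ⟨c, hc⟩ := hM p m
    have h := ab_ac12 hq ha hb hm hc
    have h1 := ih p x m a c ha hc
    have h2 := ih p y m b c hb hc
    rw [dist_comm x m, hm.1] at h1
    rw [dist_comm y m, hm.2] at h2
    have t1 := dist_triangle p x m
    have t2 := dist_triangle p y m
    rw [dist_comm x m, hm.1] at t1
    rw [dist_comm y m, hm.2] at t2
    have p1 := dist_nonneg (x := p) (y := x)
    have p2 := dist_nonneg (x := p) (y := y)
    have p3 := dist_nonneg (x := x) (y := y)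
    have e0 : (0:ℝ) ≤ (1 / 2) ^ n := by positivity
    have e1 : ((1:ℝ) / 2) ^ n ≤ 1 := pow_le_one₀ (by norm_num) (by norm_num)
    rw [pow_succ]
    generalize ((1:ℝ) / 2) ^ n = e at *
    generalize dist x y = L at *
    generalize dist p m = D at *
    have hs : dist a c + dist b c ≤ 2 * L + e * (2 * (dist p x + dist p y) + L) := by
      have : e * (2 * D) ≤ e * (dist p x + dist p y + L) :=
        mul_le_mul_of_nonneg_left (by linarith) e0
      nlinarith
    have hS : 0 ≤ dist p x + dist p y := by linarith
    generalize dist p x + dist p y = S at *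
    refine abs_le_of_sq_le_sq' ?_ (by positivity) |>.2
    have h3 := mul_le_mul_of_nonneg_left hs p3
    have h4 : e * L ^ 2 ≤ 1 * L ^ 2 := by gcongr
    nlinarith [mul_nonneg e0 (mul_nonneg p3 hS), sq_nonneg (e * S), sq_nonneg L]

lemma lip12 (hq : Quad12 H) (hM : Mids12 H) {p x y a b : H}
    (ha : IsMidpt12 a p x) (hb : IsMidpt12 b p y) : dist a b ≤ 2 * dist x y := by
  have h : Tendsto (fun n : ℕ => 2 * dist x y + ((1:ℝ) / 2) ^ n * (dist p x + dist p y)) atTop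
      (nhds (2 * dist x y + 0 * (dist p x + dist p y))) :=
    ((tendsto_pow_atTop_nhds_zero_of_lt_one (by norm_num) (by norm_num)).mul_const _).const_add _
  simpa using ge_of_tendsto' h (fun n => lip12_aux hq hM n p x y a b ha hb)

lemma ab_of_sd12 (hq : Quad12 H) (hM : Mids12 H) {μ : ℝ} (hμ : 0 ≤ μ)
    (h : ∀ p x a y : H, IsMidpt12 a p x → sd12 p x a y ≤ μ * dist x y ^ 2)
    {p x y a b : H} (ha : IsMidpt12 a p x) (hb : IsMidpt12 b p y) :
    dist a b ≤ (1 + μ) / 2 * dist x y := by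
  obtain ⟨m, hm⟩ := hM x y
  have h0 := sq_ab12 hq ha hb hm
  have h1 := h p x a m ha
  have h2 := h p y b m hb
  rw [dist_comm x m, hm.1] at h1
  rw [dist_comm y m, hm.2] at h2
  refine abs_le_of_sq_le_sq' ?_ (by positivity) |>.2
  nlinarith [sq_nonneg (μ * dist x y)]

lemma sd12_pow (hq : Quad12 H) (hM : Mids12 H) (n : ℕ) : ∀ p x a y : H, IsMidpt12 a p x →
    sd12 p x a y ≤ (4 * (3 / 4) ^ n) * dist x y ^ 2 := by
  induction n with
  | zero =>
    intro p x a y ha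
    obtain ⟨b, hb⟩ := hM p y
    have h1 := sd12_le_one hq ha hb
    have h2 := lip12 hq hM ha hb
    have := dist_nonneg (x := x) (y := y)
    simp
    nlinarith
  | succ n ih =>
    intro p x a y ha
    obtain ⟨m, hm⟩ := hM x y
    obtain ⟨c, hc⟩ := hM p m
    have e0 : (0:ℝ) ≤ 4 * (3 / 4) ^ n := by positivity
    have h1 := ab_of_sd12 hq hM e0 ih ha hc
    have h2 := ih p x a m ha
    have h3 := ih p m c y hc
    have h4 := hq a c y m
    have hr : (4:ℝ) * (3 / 4) ^ (n + 1) = 3 / 4 * (4 * (3 / 4) ^ n) := by ring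
    rw [hr]
    generalize (4:ℝ) * (3 / 4) ^ n = μ at *
    unfold sd12 at *
    rw [dist_comm x m, hm.1] at h1 h2
    rw [hm.2] at h3
    rw [dist_comm y m, hm.2, hc.2] at h4
    have := dist_nonneg (x := x) (y := y)
    nlinarith

lemma sd12_nonpos (hq : Quad12 H) (hM : Mids12 H) {p x a : H} (ha : IsMidpt12 a p x) (y : H) :
    sd12 p x a y ≤ 0 := by
  have h : Tendsto (fun n : ℕ => (4 * ((3:ℝ) / 4) ^ n) * dist x y ^ 2) atTop
      (nhds ((4 * 0) * dist x y ^ 2)) :=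
    ((tendsto_pow_atTop_nhds_zero_of_lt_one (by norm_num) (by norm_num)).const_mul _).mul_const _
  simpa using ge_of_tendsto' h (fun n => sd12_pow hq hM n p x a y ha)

lemma ab_half12 (hq : Quad12 H) (hM : Mids12 H)
    {p x y a b : H} (ha : IsMidpt12 a p x) (hb : IsMidpt12 b p y) :
    dist a b ≤ dist x y / 2 := by
  have := ab_of_sd12 hq hM le_rfl (fun p x a y ha => by simpa using sd12_nonpos hq hM ha y) ha hb
  linarith

lemma bdd_mid12 (h : ℝ → ℝ) (B : ℝ) (hB : ∀ t ∈ Set.Icc (0:ℝ) 1, h t ≤ B)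
    (h0 : h 0 ≤ 0) (h1 : h 1 ≤ 0)
    (hm : ∀ s ∈ Set.Icc (0:ℝ) 1, ∀ t ∈ Set.Icc (0:ℝ) 1, h ((s + t) / 2) ≤ (h s + h t) / 2) :
    ∀ t ∈ Set.Icc (0:ℝ) 1, h t ≤ 0 := by
  have key : ∀ n : ℕ, ∀ t ∈ Set.Icc (0:ℝ) 1, h t ≤ (1 / 2) ^ n * B := by
    intro n
    induction n with
    | zero => simpa using hB
    | succ n ih =>
      intro t ht
      rw [pow_succ]
      rcases le_total t (1 / 2) with h2 | h2
      · have hi : 2 * t ∈ Set.Icc (0:ℝ) 1 := ⟨by linarith [ht.1], by linarith⟩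
        have a1 := hm 0 (by simp) (2 * t) hi
        have a2 := ih _ hi
        rw [show (0 + 2 * t) / 2 = t by ring] at a1
        linarith
      · have hi : 2 * t - 1 ∈ Set.Icc (0:ℝ) 1 := ⟨by linarith, by linarith [ht.2]⟩
        have a1 := hm 1 (by simp) (2 * t - 1) hi
        have a2 := ih _ hi
        rw [show (1 + (2 * t - 1)) / 2 = t by ring] at a1
        linarith
  intro t ht
  have hl : Tendsto (fun n : ℕ => ((1:ℝ) / 2) ^ n * B) atTop (nhds (0 * B)) :=
    (tendsto_pow_atTop_nhds_zero_of_lt_one (by norm_num) (by norm_num)).mul_const _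
  simpa using ge_of_tendsto' hl (fun n => key n t ht)

lemma geo_mid12 {γ : ℝ → H} (hγ : IsGeodesicSeg γ) {s t : ℝ} (hs : s ∈ Set.Icc (0:ℝ) 1)
    (ht : t ∈ Set.Icc (0:ℝ) 1) : IsMidpt12 (γ ((s + t) / 2)) (γ s) (γ t) := by
  have hm : (s + t) / 2 ∈ Set.Icc (0:ℝ) 1 :=
    ⟨by linarith [hs.1, ht.1], by linarith [hs.2, ht.2]⟩
  constructor
  · rw [hγ _ hm _ hs, hγ _ hs _ ht, show (s + t) / 2 - s = -((s - t) / 2) by ring, abs_neg,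
      abs_div, abs_two]
    ring
  · rw [hγ _ hm _ ht, hγ _ hs _ ht, show (s + t) / 2 - t = (s - t) / 2 by ring,
      abs_div, abs_two]
    ring

lemma cat12 (hq : Quad12 H) (hM : Mids12 H) {γ : ℝ → H} (hγ : IsGeodesicSeg γ) (p : H)
    {t : ℝ} (ht : t ∈ Set.Icc (0:ℝ) 1) :
    dist (γ t) p ^ 2 ≤ (1 - t) * dist (γ 0) p ^ 2 + t * dist (γ 1) p ^ 2
      - t * (1 - t) * dist (γ 0) (γ 1) ^ 2 := by
  have := bdd_mid12 (fun t => dist (γ t) p ^ 2 - ((1 - t) * dist (γ 0) p ^ 2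
      + t * dist (γ 1) p ^ 2 - t * (1 - t) * dist (γ 0) (γ 1) ^ 2))
    ((dist (γ 0) (γ 1) + dist (γ 0) p) ^ 2 + dist (γ 0) (γ 1) ^ 2) ?_ (by simp) (by simp) ?_ t ht
  · simpa using this
  · intro t ht
    have h1 := dist_triangle (γ t) (γ 0) p
    rw [hγ t ht 0 (by simp)] at h1
    obtain ⟨h2, h3⟩ := ht
    rw [sub_zero, abs_of_nonneg h2] at h1
    have h4 : t * dist (γ 0) (γ 1) ≤ 1 * dist (γ 0) (γ 1) := by gcongr
    have h5 : dist (γ t) p ^ 2 ≤ (dist (γ 0) (γ 1) + dist (γ 0) p) ^ 2 := by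
      gcongr; linarith
    have h6 : 0 ≤ (1 - t) * dist (γ 0) p ^ 2 := mul_nonneg (by linarith) (sq_nonneg _)
    have h7 : 0 ≤ t * dist (γ 1) p ^ 2 := by positivity
    have h8 : t * (1 - t) * dist (γ 0) (γ 1) ^ 2 ≤ 1 * dist (γ 0) (γ 1) ^ 2 := by
      gcongr; nlinarith
    linarith
  · intro s hs t ht
    have h := sd12_nonpos hq hM (geo_mid12 hγ hs ht) p
    unfold sd12 at h
    have e : dist (γ s) (γ t) ^ 2 = (s - t) ^ 2 * dist (γ 0) (γ 1) ^ 2 := by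
      rw [hγ s hs t ht, mul_pow, sq_abs]
    rw [e] at h
    nlinarith

lemma bus12 (hq : Quad12 H) (hM : Mids12 H) {γ η : ℝ → H} (hγ : IsGeodesicSeg γ)
    (hη : IsGeodesicSeg η) {t : ℝ} (ht : t ∈ Set.Icc (0:ℝ) 1) :
    dist (γ t) (η t) ≤ (1 - t) * dist (γ 0) (η 0) + t * dist (γ 1) (η 1) := by
  have := bdd_mid12 (fun t => dist (γ t) (η t) - ((1 - t) * dist (γ 0) (η 0)
      + t * dist (γ 1) (η 1)))
    (dist (γ 0) (γ 1) + dist (γ 0) (η 0) + dist (η 0) (η 1)) ?_ (by simp) (by simp) ?_ t ht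
  · simpa using this
  · intro t ht
    have h1 := dist_triangle4 (γ t) (γ 0) (η 0) (η t)
    rw [hγ t ht 0 (by simp), hη 0 (by simp) t ht] at h1
    obtain ⟨h2, h3⟩ := ht
    rw [sub_zero, zero_sub, abs_neg, abs_of_nonneg h2] at h1
    have h4 : t * dist (γ 0) (γ 1) ≤ 1 * dist (γ 0) (γ 1) := by gcongr
    have h5 : t * dist (η 0) (η 1) ≤ 1 * dist (η 0) (η 1) := by gcongr
    have h6 : 0 ≤ (1 - t) * dist (γ 0) (η 0) := mul_nonneg (by linarith) dist_nonneg
    have h7 : 0 ≤ t * dist (γ 1) (η 1) := by positivity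
    linarith
  · intro s hs t ht
    obtain ⟨c, hc⟩ := hM (γ s) (η t)
    have h1 := ab_half12 hq hM (geo_mid12 hγ hs ht) hc
    have hc2 : IsMidpt12 c (η t) (γ s) := by
      constructor
      · rw [dist_comm (η t)]; exact hc.2
      · rw [dist_comm (η t)]; exact hc.1
    have hm := geo_mid12 hη ht hs
    rw [add_comm t s] at hm
    have h2 := ab_half12 hq hM hc2 hm
    have h3 := dist_triangle (γ ((s + t) / 2)) c (η ((s + t) / 2))
    linarith

end

/-- For an Hadamard space `H` and `φ : ℝ≥0 → ℝ≥0` increasing and convex, the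
anisotropic functional `J₁` is convex on `H^G` (along tuples of geodesics);
if moreover `V = G` or `φ` is strictly convex, then `J₁` is strictly convex. -/
theorem stmt_12 {H : Type*} [MetricSpace H] [CompleteSpace H]
    (hgeo : ∀ x y : H, ∃ γ : ℝ → H, γ 0 = x ∧ γ 1 = y ∧ IsGeodesicSeg γ)
    (hcat : ∀ x y v w : H,
      dist x v ^ 2 + dist y w ^ 2
        ≤ dist x w ^ 2 + dist y v ^ 2 + 2 * dist x y * dist v w)
    (G : Type*) [Fintype G] (V : Finset G) (hVne : V.Nonempty)
    (N : G → Finset G) (i₀ : G) (hi₀ : i₀ ∈ V)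
    (hconn : ∀ j : G, Relation.ReflTransGen (fun i i' => i' ∈ N i) i₀ j)
    (f : G → H) (φ : ℝ → ℝ) (hφnn : ∀ t, 0 ≤ t → 0 ≤ φ t)
    (hφmono : MonotoneOn φ (Set.Ici 0)) (hφconv : ConvexOn ℝ (Set.Ici 0) φ)
    (lam : ℝ) (hlam : 0 < lam) :
    let J : (G → H) → ℝ := fun u =>
      (1 / 2) * ∑ i ∈ V, dist (u i) (f i) ^ 2
        + lam * ∑ i : G, ∑ j ∈ N i, φ (dist (u i) (u j))
    (∀ γ : G → ℝ → H, (∀ i, IsGeodesicSeg (γ i)) → ∀ t ∈ Set.Icc (0 : ℝ) 1,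
        J (fun i => γ i t) ≤ (1 - t) * J (fun i => γ i 0) + t * J (fun i => γ i 1)) ∧
      ((V = Finset.univ ∨ StrictConvexOn ℝ (Set.Ici 0) φ) →
        ∀ γ : G → ℝ → H, (∀ i, IsGeodesicSeg (γ i)) →
          (fun i => γ i 0) ≠ (fun i => γ i 1) →
          ∀ t ∈ Set.Ioo (0 : ℝ) 1,
            J (fun i => γ i t)
              < (1 - t) * J (fun i => γ i 0) + t * J (fun i => γ i 1)) := by
  have hq : Quad12 H := hcat
  have hM : Mids12 H := by
    intro x y
    obtain ⟨γ, h0, h1, hγ⟩ := hgeo x y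
    have := geo_mid12 hγ (s := 0) (t := 1) (by simp) (by simp)
    rw [h0, h1] at this
    exact ⟨_, this⟩
  intro J
  have hA : ∀ γ : G → ℝ → H, (∀ i, IsGeodesicSeg (γ i)) → ∀ t ∈ Set.Icc (0 : ℝ) 1, ∀ i,
      0 ≤ (1 - t) * dist (γ i 0) (f i) ^ 2 + t * dist (γ i 1) (f i) ^ 2
        - dist (γ i t) (f i) ^ 2 := by
    intro γ hγ t ht i
    have := cat12 hq hM (hγ i) (f i) ht
    have : 0 ≤ t * (1 - t) * dist (γ i 0) (γ i 1) ^ 2 :=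
      mul_nonneg (mul_nonneg ht.1 (by linarith [ht.2])) (sq_nonneg _)
    linarith
  have hC : ∀ t ∈ Set.Icc (0 : ℝ) 1, ∀ a b : ℝ, 0 ≤ a → 0 ≤ b →
      φ ((1 - t) * a + t * b) ≤ (1 - t) * φ a + t * φ b := by
    intro t ht a b ha hb
    exact hφconv.2 ha hb (by linarith [ht.2]) ht.1 (by ring)
  have hB : ∀ γ : G → ℝ → H, (∀ i, IsGeodesicSeg (γ i)) → ∀ t ∈ Set.Icc (0 : ℝ) 1, ∀ i j,
      0 ≤ (1 - t) * φ (dist (γ i 0) (γ j 0)) + t * φ (dist (γ i 1) (γ j 1))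
        - φ (dist (γ i t) (γ j t)) := by
    intro γ hγ t ht i j
    have h1 := bus12 hq hM (hγ i) (hγ j) ht
    have h2 := hφmono (Set.mem_Ici.2 dist_nonneg) (Set.mem_Ici.2 (dist_nonneg.trans h1)) h1
    have h3 := hC t ht _ _ (dist_nonneg (x := γ i 0) (y := γ j 0))
      (dist_nonneg (x := γ i 1) (y := γ j 1))
    linarith
  have hJ : ∀ (γ : G → ℝ → H) (t : ℝ),
      (1 - t) * J (fun i => γ i 0) + t * J (fun i => γ i 1) - J (fun i => γ i t)
      = (1 / 2) * ∑ i ∈ V, ((1 - t) * dist (γ i 0) (f i) ^ 2 + t * dist (γ i 1) (f i) ^ 2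
        - dist (γ i t) (f i) ^ 2)
        + lam * ∑ i : G, ∑ j ∈ N i, ((1 - t) * φ (dist (γ i 0) (γ j 0))
          + t * φ (dist (γ i 1) (γ j 1)) - φ (dist (γ i t) (γ j t))) := by
    intro γ t
    simp only [J, Finset.sum_sub_distrib, Finset.sum_add_distrib, ← Finset.mul_sum]
    ring
  refine ⟨?_, ?_⟩
  · intro γ hγ t ht
    rw [← sub_nonneg, hJ]
    exact add_nonneg (mul_nonneg (by norm_num) (Finset.sum_nonneg fun i _ => hA γ hγ t ht i))
      (mul_nonneg hlam.le (Finset.sum_nonneg fun i _ => Finset.sum_nonneg fun j _ =>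
        hB γ hγ t ht i j))
  · intro hor γ hγ hne t ht'
    have ht : t ∈ Set.Icc (0:ℝ) 1 := ⟨ht'.1.le, ht'.2.le⟩
    have htt : 0 < t * (1 - t) := mul_pos ht'.1 (by linarith [ht'.2])
    by_contra hcon
    have h1 := hJ γ t
    have s1 : 0 ≤ ∑ i ∈ V, ((1 - t) * dist (γ i 0) (f i) ^ 2 + t * dist (γ i 1) (f i) ^ 2
        - dist (γ i t) (f i) ^ 2) := Finset.sum_nonneg fun i _ => hA γ hγ t ht i
    have s2' : ∀ i ∈ Finset.univ, 0 ≤ ∑ j ∈ N i, ((1 - t) * φ (dist (γ i 0) (γ j 0))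
          + t * φ (dist (γ i 1) (γ j 1)) - φ (dist (γ i t) (γ j t))) :=
      fun i _ => Finset.sum_nonneg fun j _ => hB γ hγ t ht i j
    have s2 := Finset.sum_nonneg s2'
    have s3 := mul_nonneg hlam.le s2
    have e1 : ∑ i ∈ V, ((1 - t) * dist (γ i 0) (f i) ^ 2 + t * dist (γ i 1) (f i) ^ 2
        - dist (γ i t) (f i) ^ 2) = 0 := by linarith
    rw [e1] at h1
    have e2 := (mul_eq_zero.1 (le_antisymm (by linarith) s3)).resolve_left hlam.ne'
    rw [Finset.sum_eq_zero_iff_of_nonneg (fun i _ => hA γ hγ t ht i)] at e1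
    rw [Finset.sum_eq_zero_iff_of_nonneg s2'] at e2
    have cV : ∀ i ∈ V, γ i 0 = γ i 1 := by
      intro i hi
      have h2 := e1 i hi
      have h3 := cat12 hq hM (hγ i) (f i) ht
      have h4 : t * (1 - t) * dist (γ i 0) (γ i 1) ^ 2 ≤ 0 := by linarith
      have h5 : dist (γ i 0) (γ i 1) ^ 2 ≤ 0 := nonpos_of_mul_nonpos_right h4 htt
      exact dist_eq_zero.1 (pow_eq_zero_iff (by norm_num) |>.1 (le_antisymm h5 (sq_nonneg _)))
    apply hne
    funext i
    rcases hor with hV | hs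
    · exact cV i (by rw [hV]; exact Finset.mem_univ i)
    · have hall := hconn i
      induction hall with
      | refl => exact cV i₀ hi₀
      | @tail i j _ hij ih =>
        have hit : γ i t = γ i 0 := by
          have := hγ i t ht 0 (by simp)
          rw [ih, dist_self, mul_zero] at this
          rw [dist_eq_zero.1 this, ih]
        have e3 := (Finset.sum_eq_zero_iff_of_nonneg (fun j _ => hB γ hγ t ht i j)).1
          (e2 i (Finset.mem_univ i)) j hij
        have hb := bus12 hq hM (hγ i) (hγ j) ht
        have hc := cat12 hq hM (hγ j) (γ i 0) ht
        rw [hit, ← ih] at e3 hb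
        rw [dist_comm _ (γ i 0), dist_comm _ (γ i 0), dist_comm _ (γ i 0)] at hc
        have hd : dist (γ i 0) (γ j 0) = dist (γ i 0) (γ j 1) := by
          by_contra hne'
          have h2 := hφmono (Set.mem_Ici.2 dist_nonneg) (Set.mem_Ici.2 (dist_nonneg.trans hb)) hb
          have h3 := hs.2 (Set.mem_Ici.2 dist_nonneg) (Set.mem_Ici.2 dist_nonneg) hne'
            (show 0 < 1 - t by linarith [ht'.2]) ht'.1 (by ring)
          simp only [smul_eq_mul] at h3
          linarith
        rw [← hd] at e3 hb hc
        have hle : dist (γ i 0) (γ j t) ≤ dist (γ i 0) (γ j 0) := by linarith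
        have heq : dist (γ i 0) (γ j t) = dist (γ i 0) (γ j 0) := by
          by_contra hne'
          have h3 := hs.2 (Set.mem_Ici.2 dist_nonneg) (Set.mem_Ici.2 dist_nonneg) hne'
            (show (0:ℝ) < 1 / 2 by norm_num) (show (0:ℝ) < 1 / 2 by norm_num) (by norm_num)
          simp only [smul_eq_mul] at h3
          have h0 := dist_nonneg (x := γ i 0) (y := γ j t)
          have h2 := hφmono (a := dist (γ i 0) (γ j t))
            (b := 1 / 2 * dist (γ i 0) (γ j t) + 1 / 2 * dist (γ i 0) (γ j 0))
            (Set.mem_Ici.2 h0) (Set.mem_Ici.2 (by linarith)) (by linarith)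
          linarith
        rw [heq] at hc
        have h4 : t * (1 - t) * dist (γ j 0) (γ j 1) ^ 2 ≤ 0 := by linarith
        have h5 : dist (γ j 0) (γ j 1) ^ 2 ≤ 0 := nonpos_of_mul_nonpos_right h4 htt
        exact dist_eq_zero.1 (pow_eq_zero_iff (by norm_num) |>.1 (le_antisymm h5 (sq_nonneg _)))
end

section
/- Let (H,d) be an Hadamard space and f: V → H, V ⊆ G nonempty. If V = G, then the isotropic functional J₂(u) := (1/2)Σ_{i∈V} d(u_i,f_i)² + λ Σ_{i∈G} φ((Σ_{j∈N(i)⁺} d(u_i,u_j)²)^{1/2}) with φ increasing and convex is strictly convex and coercive on H^G, and hence has a unique minimizer. -/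
open Filter

/-- the trapezoid step -/
theorem aux_trap (t s L D A B C E : ℝ) (ht : 0 < t)
    (h : A ^ 2 + B ^ 2 ≤ ((1 - t) * (s * L)) ^ 2 + ((1 - t) * D) ^ 2 + 2 * C * E) :
    t * (t * (s ^ 2 * L ^ 2 + D ^ 2 - C ^ 2) - (s ^ 2 * L ^ 2 + t ^ 2 * D ^ 2 - A ^ 2)) ≤
      t * ((t * s) ^ 2 * L ^ 2 + D ^ 2 - B ^ 2)
        - ((t * s) ^ 2 * L ^ 2 + t ^ 2 * D ^ 2 - E ^ 2) := by
  have h1 := mul_le_mul_of_nonneg_left h ht.le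
  nlinarith [sq_nonneg (t * C - E)]

theorem aux_lim (t s L D D' P Q R : ℝ) (ht1 : t < 1)
    (hQ : (D - (1 - t) * D') ^ 2 ≤ Q ^ 2)
    (h : Q ^ 2 + R ^ 2 ≤ (t * D) ^ 2 + (t * D') ^ 2 + 2 * (s * L) * P) :
    t * (s ^ 2 * L ^ 2 + D ^ 2 - D' ^ 2) - (s ^ 2 * L ^ 2 + t ^ 2 * D ^ 2 - R ^ 2)
      ≤ 2 * (s * L) * P := by
  have := mul_nonneg (sub_nonneg.2 ht1.le) (sq_nonneg (s * L))
  have := mul_nonneg (sub_nonneg.2 ht1.le) (sq_nonneg (D - D'))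
  nlinarith


theorem aux_D2 {H : Type*} [MetricSpace H]
    (hgeo : ∀ x y : H, ∃ γ : ℝ → H, γ 0 = x ∧ γ 1 = y ∧ IsGeodesicSeg γ)
    (hcat : ∀ x y v w : H,
      dist x v ^ 2 + dist y w ^ 2
        ≤ dist x w ^ 2 + dist y v ^ 2 + 2 * dist x y * dist v w)
    (γ : ℝ → H) (hγ : IsGeodesicSeg γ) (x : H) (t : ℝ) (ht : t ∈ Set.Icc (0 : ℝ) 1) :
    dist x (γ t) ^ 2 ≤ (1 - t) * dist x (γ 0) ^ 2 + t * dist x (γ 1) ^ 2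
      - t * (1 - t) * dist (γ 0) (γ 1) ^ 2 := by
  rcases eq_or_lt_of_le ht.1 with rfl | ht0
  · simp
  rcases eq_or_lt_of_le ht.2 with rfl | ht1
  · simp
  obtain ⟨ξ, hξ0, hξ1, hξ⟩ := hgeo (γ 0) x
  have I0 : (0 : ℝ) ∈ Set.Icc (0 : ℝ) 1 := by simp
  have I1 : (1 : ℝ) ∈ Set.Icc (0 : ℝ) 1 := by simp
  set L := dist (γ 0) x with hL
  set D := dist (γ 0) (γ 1) with hD
  have hL0 : 0 ≤ L := dist_nonneg
  have hD0 : 0 ≤ D := dist_nonneg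
  have hmp : dist (γ 0) (γ t) = t * D := by
    rw [hγ 0 I0 t ht, zero_sub, abs_neg, abs_of_pos ht0]
  have hpz : dist (γ t) (γ 1) = (1 - t) * D := by
    rw [hγ t ht 1 I1, abs_sub_comm, abs_of_pos (by linarith)]
  let Gf : ℝ → ℝ := fun s => t * (s ^ 2 * L ^ 2 + D ^ 2 - dist (ξ s) (γ 1) ^ 2)
    - (s ^ 2 * L ^ 2 + t ^ 2 * D ^ 2 - dist (ξ s) (γ t) ^ 2)
  have step : ∀ s ∈ Set.Icc (0 : ℝ) 1, t * Gf s ≤ Gf (t * s) := by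
    intro s hs
    have hts : t * s ∈ Set.Icc (0 : ℝ) 1 :=
      ⟨mul_nonneg ht0.le hs.1, by nlinarith [hs.1, hs.2]⟩
    apply aux_trap t s L D _ _ _ _ ht0
    have h1 := hcat (ξ s) (γ 1) (γ t) (ξ (t * s))
    have h2 : dist (ξ s) (ξ (t * s)) = (1 - t) * (s * L) := by
      rw [hξ s hs _ hts, hξ0, hξ1, abs_of_nonneg (by nlinarith [hs.1])]; ring
    rw [h2, dist_comm (γ 1) (γ t), hpz, dist_comm (γ 1) (ξ (t * s)),
      dist_comm (γ t) (ξ (t * s))] at h1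
    exact h1
  have bound : ∀ s ∈ Set.Icc (0 : ℝ) 1, Gf s ≤ 2 * (s * L) *
      Real.sqrt (s * (4 * L * (D + L) + 4 * L * D + L ^ 2)) := by
    intro s hs
    obtain ⟨η, hη0, hη1, hη⟩ := hgeo (ξ s) (γ 1)
    have hms : dist (γ 0) (ξ s) = s * L := by
      have := hξ 0 I0 s hs
      rw [hξ0, hξ1, zero_sub, abs_neg, abs_of_nonneg hs.1] at this
      exact this
    set D' := dist (ξ s) (γ 1) with hD'
    have hsq : dist (ξ s) (η t) = t * D' := by
      have := hη 0 I0 t ht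
      rw [hη0, hη1, zero_sub, abs_neg, abs_of_pos ht0] at this
      exact this
    have hqz : dist (η t) (γ 1) = (1 - t) * D' := by
      have := hη t ht 1 I1
      rw [hη0, hη1, abs_sub_comm, abs_of_pos (by linarith)] at this
      exact this
    have hD'0 : 0 ≤ D' := dist_nonneg
    have hsL : 0 ≤ s * L := mul_nonneg hs.1 hL0
    have hsL1 : s * L ≤ L := by nlinarith [hs.2]
    have hD'D : D' ≤ D + s * L := by
      have := dist_triangle (ξ s) (γ 0) (γ 1)
      rw [dist_comm (ξ s) (γ 0), hms] at this
      linarith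
    have hmq : dist (γ 0) (η t) ≤ s * L + t * D' := by
      have := dist_triangle (γ 0) (ξ s) (η t)
      linarith
    have main : Gf s ≤ 2 * (s * L) * dist (γ t) (η t) := by
      apply aux_lim t s L D D' _ (dist (γ 0) (η t)) _ ht1
      · rw [sq_le_sq, ← hqz, abs_of_nonneg (dist_nonneg (x := γ 0))]
        have := abs_dist_sub_le (γ 0) (η t) (γ 1)
        exact this
      · have h1 := hcat (γ 0) (ξ s) (η t) (γ t)
        rw [hmp, hsq, hms, dist_comm (η t)] at h1
        exact h1
    refine main.trans (mul_le_mul_of_nonneg_left ?_ (by positivity))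
    apply Real.le_sqrt_of_sq_le
    have h1 := hcat (γ t) (γ 1) (η t) (γ 0)
    rw [dist_comm (γ 1) (γ 0), dist_comm (γ t) (γ 0), hmp, dist_comm (γ 1) (η t), hqz, hpz,
      dist_comm (η t) (γ 0)] at h1
    have h2 : 2 * ((1 - t) * D) * dist (γ 0) (η t) ≤ 2 * ((1 - t) * D) * (s * L + t * (D + s * L)) := by
      apply mul_le_mul_of_nonneg_left
      · nlinarith
      · have : 0 ≤ 1 - t := by linarith
        positivity
    have h3 : ((1 - t) * D') ^ 2 ≤ ((1 - t) * (D + s * L)) ^ 2 := by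
      have : 0 ≤ 1 - t := by linarith
      gcongr
    have h4 : dist (γ t) (η t) ^ 2 ≤ (t * D) ^ 2 + ((1 - t) * (D + s * L)) ^ 2 +
      2 * ((1 - t) * D) * (s * L + t * (D + s * L)) - D ^ 2 := by linarith
    have h5 : (t * D) ^ 2 + ((1 - t) * (D + s * L)) ^ 2 +
      2 * ((1 - t) * D) * (s * L + t * (D + s * L)) - D ^ 2
      = (1 - t) ^ 2 * (s * L) ^ 2 + 4 * (1 - t) * D * (s * L) := by ring
    have h6 : (1 - t) ^ 2 * (s * L) ^ 2 ≤ 1 * ((s * L) * L) := by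
      apply mul_le_mul
      · nlinarith
      · nlinarith
      · positivity
      · norm_num
    have h7 : 4 * (1 - t) * D * (s * L) ≤ 4 * D * (s * L) := by
      have : 0 ≤ D * (s * L) := by positivity
      nlinarith
    have h8 : 0 ≤ 4 * (s * L * (L + D)) := by positivity
    have h9 : s * (4 * L * (D + L) + 4 * L * D + L ^ 2)
        = 1 * ((s * L) * L) + 4 * D * (s * L) + 4 * (s * L * (L + D)) := by ring
    rw [h9]
    linarith
  have pw : ∀ k : ℕ, t ^ k ∈ Set.Icc (0 : ℝ) 1 := fun k =>
    ⟨by positivity, pow_le_one₀ ht0.le ht1.le⟩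
  have iter : ∀ k : ℕ, t ^ k * Gf 1 ≤ Gf (t ^ k) := by
    intro k
    induction k with
    | zero => simp
    | succ k ih =>
      have h1 := step _ (pw k)
      have h2 := mul_le_mul_of_nonneg_left ih ht0.le
      rw [pow_succ']
      linarith
  set C := 4 * L * (D + L) + 4 * L * D + L ^ 2 with hC
  have fin : ∀ k : ℕ, Gf 1 ≤ 2 * L * Real.sqrt (t ^ k * C) := by
    intro k
    have h1 := (iter k).trans (bound _ (pw k))
    have h2 : 0 < t ^ k := by positivity
    apply le_of_mul_le_mul_left _ h2
    linarith
  have lim : Tendsto (fun k : ℕ => 2 * L * Real.sqrt (t ^ k * C)) atTop (nhds 0) := by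
    have h1 := tendsto_pow_atTop_nhds_zero_of_lt_one ht0.le ht1
    have h2 := (Real.continuous_sqrt.tendsto _).comp (h1.mul_const C)
    have h3 := h2.const_mul (2 * L)
    simpa using h3
  have g1 : Gf 1 ≤ 0 := ge_of_tendsto' lim fin
  simp only [Gf, hξ1] at g1
  rw [dist_comm x (γ 0)]
  linarith

theorem aux_conv_s13 {H : Type*} [MetricSpace H]
    (hgeo : ∀ x y : H, ∃ γ : ℝ → H, γ 0 = x ∧ γ 1 = y ∧ IsGeodesicSeg γ)
    (hcat : ∀ x y v w : H,
      dist x v ^ 2 + dist y w ^ 2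
        ≤ dist x w ^ 2 + dist y v ^ 2 + 2 * dist x y * dist v w)
    (γ η : ℝ → H) (hγ : IsGeodesicSeg γ) (hη : IsGeodesicSeg η) (t : ℝ)
    (ht : t ∈ Set.Icc (0 : ℝ) 1) :
    dist (γ t) (η t) ≤ (1 - t) * dist (γ 0) (η 0) + t * dist (γ 1) (η 1) := by
  have t0 := ht.1
  have t1 : 0 ≤ 1 - t := by linarith [ht.2]
  refine (sq_le_sq₀ dist_nonneg (by positivity)).1 ?_
  have a := aux_D2 hgeo hcat γ hγ (η t) t ht
  have b0 := aux_D2 hgeo hcat η hη (γ 0) t ht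
  have b1 := aux_D2 hgeo hcat η hη (γ 1) t ht
  have c := hcat (γ 0) (γ 1) (η 1) (η 0)
  have c' := hcat (γ 0) (η 0) (η 1) (γ 1)
  rw [dist_comm (η 0) (γ 1), dist_comm (η 1) (γ 1)] at c'
  rw [dist_comm (η t) (γ t), dist_comm (η t) (γ 0), dist_comm (η t) (γ 1)] at a
  have b0' := mul_le_mul_of_nonneg_left b0 t1
  have b1' := mul_le_mul_of_nonneg_left b1 t0
  have c2 := mul_le_mul_of_nonneg_left c' (mul_nonneg t0 t1)
  nlinarith

theorem aux_minkowski {ι : Type*} (s : Finset ι) (a b : ι → ℝ) (ha : ∀ i, 0 ≤ a i)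
    (hb : ∀ i, 0 ≤ b i) (t : ℝ) (t0 : 0 ≤ t) (t1 : 0 ≤ 1 - t) :
    Real.sqrt (∑ j ∈ s, ((1 - t) * a j + t * b j) ^ 2) ≤
      (1 - t) * Real.sqrt (∑ j ∈ s, a j ^ 2) + t * Real.sqrt (∑ j ∈ s, b j ^ 2) := by
  have h := Real.sum_mul_le_sqrt_mul_sqrt s a b
  have ea := Real.sq_sqrt (Finset.sum_nonneg (s := s) fun i _ => sq_nonneg (a i))
  have eb := Real.sq_sqrt (Finset.sum_nonneg (s := s) fun i _ => sq_nonneg (b i))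
  apply Real.sqrt_le_iff.2 ⟨by positivity, ?_⟩
  have e : ∑ j ∈ s, ((1 - t) * a j + t * b j) ^ 2 = (1 - t) ^ 2 * ∑ j ∈ s, a j ^ 2
      + t ^ 2 * ∑ j ∈ s, b j ^ 2 + 2 * (t * (1 - t)) * ∑ j ∈ s, a j * b j := by
    simp only [Finset.mul_sum, ← Finset.sum_add_distrib]
    exact Finset.sum_congr rfl fun i _ => by ring
  have h2 := mul_le_mul_of_nonneg_left h (mul_nonneg t0 t1)
  rw [e, ← ea, ← eb]
  rw [Real.sqrt_sq (Real.sqrt_nonneg _), Real.sqrt_sq (Real.sqrt_nonneg _)]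
  nlinarith

theorem aux_J {H : Type*} [MetricSpace H]
    (hgeo : ∀ x y : H, ∃ γ : ℝ → H, γ 0 = x ∧ γ 1 = y ∧ IsGeodesicSeg γ)
    (hcat : ∀ x y v w : H,
      dist x v ^ 2 + dist y w ^ 2
        ≤ dist x w ^ 2 + dist y v ^ 2 + 2 * dist x y * dist v w)
    (G : Type*) [Fintype G] (N : G → Finset G)
    (f : G → H) (φ : ℝ → ℝ)
    (hφmono : MonotoneOn φ (Set.Ici 0)) (hφconv : ConvexOn ℝ (Set.Ici 0) φ)
    (lam : ℝ) (hlam : 0 < lam) (J : (G → H) → ℝ)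
    (hJ : J = fun u => (1 / 2) * ∑ i : G, dist (u i) (f i) ^ 2
        + lam * ∑ i : G, φ (Real.sqrt (∑ j ∈ N i, dist (u i) (u j) ^ 2)))
    (γ : G → ℝ → H) (hγ : ∀ i, IsGeodesicSeg (γ i)) (t : ℝ) (ht : t ∈ Set.Icc (0 : ℝ) 1) :
    J (fun i => γ i t) ≤ (1 - t) * J (fun i => γ i 0) + t * J (fun i => γ i 1)
      - (1 / 2) * (t * (1 - t)) * ∑ i, dist (γ i 0) (γ i 1) ^ 2 := by
  have t0 := ht.1
  have t1 : 0 ≤ 1 - t := by linarith [ht.2]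
  have hdata : ∑ i : G, dist (γ i t) (f i) ^ 2 ≤ (1 - t) * ∑ i : G, dist (γ i 0) (f i) ^ 2
      + t * ∑ i : G, dist (γ i 1) (f i) ^ 2 - t * (1 - t) * ∑ i, dist (γ i 0) (γ i 1) ^ 2 := by
    simp only [Finset.mul_sum, ← Finset.sum_add_distrib, ← Finset.sum_sub_distrib]
    refine Finset.sum_le_sum fun i _ => ?_
    have := aux_D2 hgeo hcat (γ i) (hγ i) (f i) t ht
    simpa only [dist_comm (f i)] using this
  have hreg : ∑ i : G, φ (Real.sqrt (∑ j ∈ N i, dist (γ i t) (γ j t) ^ 2)) ≤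
      (1 - t) * ∑ i : G, φ (Real.sqrt (∑ j ∈ N i, dist (γ i 0) (γ j 0) ^ 2))
      + t * ∑ i : G, φ (Real.sqrt (∑ j ∈ N i, dist (γ i 1) (γ j 1) ^ 2)) := by
    simp only [Finset.mul_sum, ← Finset.sum_add_distrib]
    refine Finset.sum_le_sum fun i _ => ?_
    have h1 := aux_minkowski (N i) (fun j => dist (γ i 0) (γ j 0)) (fun j => dist (γ i 1) (γ j 1))
      (fun _ => dist_nonneg) (fun _ => dist_nonneg) t t0 t1
    have h2 : Real.sqrt (∑ j ∈ N i, dist (γ i t) (γ j t) ^ 2) ≤ Real.sqrt (∑ j ∈ N i,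
        ((1 - t) * dist (γ i 0) (γ j 0) + t * dist (γ i 1) (γ j 1)) ^ 2) := by
      apply Real.sqrt_le_sqrt
      refine Finset.sum_le_sum fun j _ => ?_
      have := aux_conv_s13 hgeo hcat (γ i) (γ j) (hγ i) (hγ j) t ht
      gcongr
    have h3 := hφmono (Set.mem_Ici.2 (Real.sqrt_nonneg _)) (Set.mem_Ici.2 (by positivity))
      (h2.trans h1)
    have h4 := hφconv.2 (Set.mem_Ici.2 (Real.sqrt_nonneg (∑ j ∈ N i, dist (γ i 0) (γ j 0) ^ 2)))
      (Set.mem_Ici.2 (Real.sqrt_nonneg (∑ j ∈ N i, dist (γ i 1) (γ j 1) ^ 2))) t1 t0 (by ring)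
    simp only [smul_eq_mul] at h4
    exact h3.trans h4
  have h5 := mul_le_mul_of_nonneg_left hreg hlam.le
  simp only [hJ]
  linarith

theorem aux_cont (φ : ℝ → ℝ) (hφmono : MonotoneOn φ (Set.Ici 0))
    (hφconv : ConvexOn ℝ (Set.Ici 0) φ) : Continuous (fun r => φ (max r 0)) := by
  have hc : ConvexOn ℝ Set.univ (fun r : ℝ => φ (max r 0)) := by
    refine ⟨convex_univ, fun x _ y _ a b ha hb hab => ?_⟩
    have h1 := hφconv.2 (Set.mem_Ici.2 (le_max_right x 0)) (Set.mem_Ici.2 (le_max_right y 0))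
      ha hb hab
    refine le_trans (hφmono (Set.mem_Ici.2 (le_max_right _ 0)) (Set.mem_Ici.2 ?_) ?_) h1
    · simp only [smul_eq_mul]; positivity
    · simp only [smul_eq_mul]
      apply max_le
      · gcongr <;> exact le_max_left _ _
      · positivity
  exact continuousOn_univ.1 (hc.continuousOn isOpen_univ)

/-- For an Hadamard space `H`, data given on all of `G` (i.e. `V = G`) and `φ`
increasing and convex, the isotropic functional `J₂` is strictly convex and
coercive on `H^G` and hence has a unique minimizer. -/
theorem stmt_13 {H : Type*} [MetricSpace H] [CompleteSpace H]
    (hgeo : ∀ x y : H, ∃ γ : ℝ → H, γ 0 = x ∧ γ 1 = y ∧ IsGeodesicSeg γ)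
    (hcat : ∀ x y v w : H,
      dist x v ^ 2 + dist y w ^ 2
        ≤ dist x w ^ 2 + dist y v ^ 2 + 2 * dist x y * dist v w)
    (G : Type*) [Fintype G] [Nonempty G] (N : G → Finset G)
    (f : G → H) (φ : ℝ → ℝ) (hφnn : ∀ t, 0 ≤ t → 0 ≤ φ t)
    (hφmono : MonotoneOn φ (Set.Ici 0)) (hφconv : ConvexOn ℝ (Set.Ici 0) φ)
    (lam : ℝ) (hlam : 0 < lam) :
    let J : (G → H) → ℝ := fun u =>
      (1 / 2) * ∑ i : G, dist (u i) (f i) ^ 2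
        + lam * ∑ i : G, φ (Real.sqrt (∑ j ∈ N i, dist (u i) (u j) ^ 2))
    (∀ γ : G → ℝ → H, (∀ i, IsGeodesicSeg (γ i)) →
        (fun i => γ i 0) ≠ (fun i => γ i 1) →
        ∀ t ∈ Set.Ioo (0 : ℝ) 1,
          J (fun i => γ i t)
            < (1 - t) * J (fun i => γ i 0) + t * J (fun i => γ i 1)) ∧
      Tendsto J (Filter.comap (fun u : G → H => dist u f) atTop) atTop ∧
      (∃! u : G → H, ∀ w : G → H, J u ≤ J w) := by
  intro J
  have hJ : J = fun u => (1 / 2) * ∑ i : G, dist (u i) (f i) ^ 2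
        + lam * ∑ i : G, φ (Real.sqrt (∑ j ∈ N i, dist (u i) (u j) ^ 2)) := rfl
  clear_value J
  have key := aux_J hgeo hcat G N f φ hφmono hφconv lam hlam J hJ
  have dsq : ∀ u w : G → H, dist u w ^ 2 ≤ ∑ i, dist (u i) (w i) ^ 2 := by
    intro u w
    have h0 : 0 ≤ ∑ i, dist (u i) (w i) ^ 2 := Finset.sum_nonneg fun i _ => sq_nonneg _
    have : dist u w ≤ Real.sqrt (∑ i, dist (u i) (w i) ^ 2) := by
      refine (dist_pi_le_iff (Real.sqrt_nonneg _)).2 fun i => Real.le_sqrt_of_sq_le ?_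
      exact Finset.single_le_sum (f := fun i => dist (u i) (w i) ^ 2)
        (fun i _ => sq_nonneg _) (Finset.mem_univ i)
    calc dist u w ^ 2 ≤ (Real.sqrt (∑ i, dist (u i) (w i) ^ 2)) ^ 2 := by gcongr
      _ = _ := Real.sq_sqrt h0
  have lower : ∀ u, (1 / 2) * dist u f ^ 2 ≤ J u := by
    intro u
    have h1 := dsq u f
    have h2 : 0 ≤ lam * ∑ i : G, φ (Real.sqrt (∑ j ∈ N i, dist (u i) (u j) ^ 2)) :=
      mul_nonneg hlam.le (Finset.sum_nonneg fun i _ => hφnn _ (Real.sqrt_nonneg _))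
    simp only [hJ]
    linarith
  have hJcont : Continuous J := by
    have hc := aux_cont φ hφmono hφconv
    have e : J = fun u => (1 / 2) * ∑ i : G, dist (u i) (f i) ^ 2
        + lam * ∑ i : G, (fun r => φ (max r 0)) (Real.sqrt (∑ j ∈ N i, dist (u i) (u j) ^ 2)) := by
      rw [hJ]
      funext u
      simp only [max_eq_left (Real.sqrt_nonneg _)]
    rw [e]
    refine Continuous.add (by fun_prop) (continuous_const.mul
      (continuous_finsetSum _ fun i _ => hc.comp (by fun_prop)))
  have mid : ∀ u w : G → H, ∃ v : G → H,
      J v ≤ (1 / 2) * J u + (1 / 2) * J w - (1 / 8) * dist u w ^ 2 := by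
    intro u w
    choose γ h0 h1 hγ using fun i => hgeo (u i) (w i)
    refine ⟨fun i => γ i (1 / 2), ?_⟩
    have h := key γ hγ (1 / 2) ⟨by norm_num, by norm_num⟩
    simp only [h0, h1] at h
    have h2 := dsq u w
    linarith
  refine ⟨?_, ?_, ?_⟩
  · intro γ hγ hne t ht
    have h := key γ hγ t ⟨ht.1.le, ht.2.le⟩
    have h2 := dsq (fun i => γ i 0) (fun i => γ i 1)
    have h3 : 0 < dist (fun i => γ i 0) (fun i => γ i 1) := dist_pos.2 hne
    have h4 : 0 < ∑ i, dist (γ i 0) (γ i 1) ^ 2 := lt_of_lt_of_le (by positivity) h2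
    have h5 : 0 < (1 / 2) * (t * (1 - t)) * ∑ i, dist (γ i 0) (γ i 1) ^ 2 := by
      have := ht.1
      have : 0 < 1 - t := by linarith [ht.2]
      positivity
    linarith
  · refine tendsto_atTop_mono lower ?_
    have h1 : Tendsto (fun u : G → H => dist u f)
        (Filter.comap (fun u : G → H => dist u f) atTop) atTop := tendsto_comap
    have h2 : Tendsto (fun r : ℝ => (1 / 2) * r ^ 2) atTop atTop :=
      (tendsto_pow_atTop two_ne_zero).const_mul_atTop (by norm_num)
    exact h2.comp h1
  · have bdd : BddBelow (Set.range J) :=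
      ⟨0, by rintro _ ⟨u, rfl⟩; exact le_trans (by positivity) (lower u)⟩
    set I := sInf (Set.range J) with hI
    have hIle : ∀ u, I ≤ J u := fun u => csInf_le bdd ⟨u, rfl⟩
    have hex : ∀ n : ℕ, ∃ u, J u < I + 1 / ((n : ℝ) + 1) := by
      intro n
      obtain ⟨_, ⟨u, rfl⟩, hu⟩ := exists_lt_of_csInf_lt (s := Set.range J) ⟨_, ⟨f, rfl⟩⟩
        (show sInf (Set.range J) < I + 1 / ((n : ℝ) + 1) from
          lt_add_of_pos_right _ (by positivity))
      exact ⟨u, hu⟩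
    choose u hu using hex
    have hd : ∀ n m K : ℕ, K ≤ n → K ≤ m →
        dist (u n) (u m) ≤ Real.sqrt (8 * (1 / ((K : ℝ) + 1))) := by
      intro n m K hn hm
      apply Real.le_sqrt_of_sq_le
      obtain ⟨v, hv⟩ := mid (u n) (u m)
      have h1 := hIle v
      have h2 := hu n
      have h3 := hu m
      have h4 : 1 / ((n : ℝ) + 1) ≤ 1 / ((K : ℝ) + 1) := by gcongr
      have h5 : 1 / ((m : ℝ) + 1) ≤ 1 / ((K : ℝ) + 1) := by gcongr
      linarith
    have hb : Tendsto (fun K : ℕ => Real.sqrt (8 * (1 / ((K : ℝ) + 1)))) atTop (nhds 0) := by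
      have h2 := (Real.continuous_sqrt.tendsto _).comp
        ((tendsto_one_div_add_atTop_nhds_zero_nat (𝕜 := ℝ)).const_mul 8)
      simpa [Function.comp_def] using h2
    have hcau : CauchySeq u := cauchySeq_of_le_tendsto_0 _ hd hb
    obtain ⟨a, ha⟩ := cauchySeq_tendsto_of_complete hcau
    have hJa : J a ≤ I := by
      have h1 : Tendsto (fun n => J (u n)) atTop (nhds (J a)) := (hJcont.tendsto a).comp ha
      have h2 : Tendsto (fun n : ℕ => I + 1 / ((n : ℝ) + 1)) atTop (nhds (I + 0)) :=
        tendsto_const_nhds.add (tendsto_one_div_add_atTop_nhds_zero_nat (𝕜 := ℝ))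
      rw [add_zero] at h2
      exact le_of_tendsto_of_tendsto' h1 h2 fun n => (hu n).le
    refine ⟨a, fun w => hJa.trans (hIle w), ?_⟩
    intro b hbm
    obtain ⟨v, hv⟩ := mid b a
    have h1 := hbm v
    have h2 := hbm a
    have h3 := hJa.trans (hIle v)
    have h4 : dist b a ^ 2 ≤ 0 := by linarith
    exact dist_eq_zero.1 (pow_eq_zero_iff two_ne_zero |>.1 (le_antisymm h4 (sq_nonneg _)))
end
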